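/- Let P and Q be real polynomials in one variable, each with all coefficients nonnegative, such that the constant coefficient of P equals 1 and P is nonconstant (it has a nonzero coefficient in some degree ≥ 1). Let ε > 0 be a real number. Then there exists a positive integer n₀ such that for every integer n ≥ n₀ and every real number t ≥ ε, one has n · Q(t) < (P(t))^n. -/

import Mathlib

open Filter Topology in
/-- Linear growth is eventually dominated by (shifted) exponential growth. -/
theorem eventually_natCast_mul_lt_pow_sub {r : ℝ} (hr : 1 < r) (C : ℝ) (d : ℕ) :
    ∀ᶠ n : ℕ in atTop, (n : ℝ) * C < r ^ (n - d) := by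
  have hr0 : 0 < r := by linarith
  have hlim : Tendsto (fun n : ℕ => (n : ℝ) / r ^ n * (C * r ^ d)) atTop (𝓝 0) := by
    simpa using (tendsto_pow_const_div_const_pow_of_one_lt 1 hr).mul_const (C * r ^ d)
  filter_upwards [hlim.eventually_lt_const one_pos, eventually_ge_atTop d] with n hn hd
  rw [div_mul_eq_mul_div, div_lt_one (by positivity), ← pow_sub_mul_pow r hd, ← mul_assoc] at hn
  exact lt_of_mul_lt_mul_right hn (by positivity)

namespace Polynomial

theorem eval_le_eval_of_coeff_nonneg {p : ℝ[X]} (hp : ∀ k, 0 ≤ p.coeff k) {s t : ℝ}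
    (hs : 0 ≤ s) (hst : s ≤ t) : p.eval s ≤ p.eval t := by
  simp only [eval_eq_sum_range]
  gcongr with i
  exact hp i

theorem eval_pos_of_coeff_nonneg {p : ℝ[X]} (hp : ∀ k, 0 ≤ p.coeff k) {j : ℕ}
    (hj : p.coeff j ≠ 0) {t : ℝ} (ht : 0 < t) : 0 < p.eval t := by
  rw [eval_eq_sum_range]
  refine Finset.sum_pos' (fun i _ => mul_nonneg (hp i) (by positivity))
    ⟨j, Finset.mem_range_succ_iff.2 (le_natDegree_of_ne_zero hj), ?_⟩
  exact mul_pos ((hp j).lt_of_ne' hj) (by positivity)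

theorem eval_mul_le_of_coeff_nonneg {p : ℝ[X]} (hp : ∀ k, 0 ≤ p.coeff k) {x u : ℝ}
    (hx : 0 ≤ x) (hu : 1 ≤ u) : p.eval (x * u) ≤ p.eval x * u ^ p.natDegree := by
  simp only [eval_eq_sum_range, Finset.sum_mul, mul_pow, ← mul_assoc]
  refine Finset.sum_le_sum fun i hi => ?_
  have := hp i
  have hi' : i ≤ p.natDegree := Finset.mem_range_succ_iff.1 hi
  gcongr

/-- A nonconstant polynomial with nonnegative coefficients and constant coefficient `1` grows
at least linearly on `[ε, ∞)`. -/
theorem exists_one_add_mul_le_eval {p : ℝ[X]} (hp : ∀ k, 0 ≤ p.coeff k) (hp0 : p.coeff 0 = 1)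
    (hnc : ∃ k, 1 ≤ k ∧ p.coeff k ≠ 0) {ε : ℝ} (hε : 0 < ε) :
    ∃ b : ℝ, 0 < b ∧ ∀ t, ε ≤ t → 1 + b * t ≤ p.eval t := by
  obtain ⟨k, hk, hpk⟩ := hnc
  have hq : ∀ j, 0 ≤ p.divX.coeff j := fun j => by simpa [coeff_divX] using hp (j + 1)
  have hqk : p.divX.coeff (k - 1) ≠ 0 := by rwa [coeff_divX, Nat.sub_add_cancel hk]
  refine ⟨p.divX.eval ε, eval_pos_of_coeff_nonneg hq hqk hε, fun t ht => ?_⟩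
  have heval : p.eval t = p.divX.eval t * t + 1 := by
    conv_lhs => rw [← divX_mul_X_add p]
    simp [hp0]
  have hmul := mul_le_mul_of_nonneg_right (eval_le_eval_of_coeff_nonneg hq hε.le ht)
    (hε.le.trans ht)
  linarith

end Polynomial

/-- Polynomial content of Theorem 3.10 (half-global version): for `P` with nonnegative
coefficients, constant coefficient 1 and nonconstant, and `Q` with nonnegative coefficients,
for all sufficiently large `n` one has `n * Q(t) < P(t)^n` for every `t ≥ ε`. -/
theorem half_global_comparison (P Q : Polynomial ℝ)
    (hP : ∀ k : ℕ, 0 ≤ P.coeff k)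
    (hQ : ∀ k : ℕ, 0 ≤ Q.coeff k)
    (hP0 : P.coeff 0 = 1)
    (hPnc : ∃ k : ℕ, 1 ≤ k ∧ P.coeff k ≠ 0)
    (ε : ℝ) (hε : 0 < ε) :
    ∃ n₀ : ℕ, 0 < n₀ ∧ ∀ n : ℕ, n₀ ≤ n → ∀ t : ℝ, ε ≤ t →
      (n : ℝ) * Q.eval t < (P.eval t) ^ n := by
  obtain ⟨b, hb, hPb⟩ := Polynomial.exists_one_add_mul_le_eval hP hP0 hPnc hε
  have hr : 1 < 1 + b * ε := lt_add_of_pos_right 1 (mul_pos hb hε)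
  obtain ⟨N, hN⟩ := Filter.eventually_atTop.1
    (eventually_natCast_mul_lt_pow_sub hr (Q.eval b⁻¹) Q.natDegree)
  refine ⟨max N Q.natDegree + 1, Nat.succ_pos _, fun n hn t ht => ?_⟩
  have hNn : N ≤ n := by omega
  have hdn : Q.natDegree ≤ n := by omega
  have ht0 : 0 < t := hε.trans_le ht
  have hu : 1 ≤ 1 + b * t := by linarith [mul_pos hb ht0]
  have htu : t ≤ b⁻¹ * (1 + b * t) := by
    rw [mul_add, inv_mul_cancel_left₀ hb.ne']
    linarith [inv_pos.2 hb]
  calc (n : ℝ) * Q.eval t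
      ≤ n * (Q.eval b⁻¹ * (1 + b * t) ^ Q.natDegree) := by
        gcongr
        exact (Polynomial.eval_le_eval_of_coeff_nonneg hQ ht0.le htu).trans
          (Polynomial.eval_mul_le_of_coeff_nonneg hQ (inv_pos.2 hb).le hu)
    _ = n * Q.eval b⁻¹ * (1 + b * t) ^ Q.natDegree := by ring
    _ < (1 + b * ε) ^ (n - Q.natDegree) * (1 + b * t) ^ Q.natDegree := by
        gcongr
        exact hN n hNn
    _ ≤ (1 + b * t) ^ (n - Q.natDegree) * (1 + b * t) ^ Q.natDegree := by gcongr
    _ = (1 + b * t) ^ n := pow_sub_mul_pow _ hdn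
    _ ≤ P.eval t ^ n := by
        gcongr
        exact hPb t ht
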